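/- Let (Φᵢ, E₊,ᵢ, E₋,ᵢ) be a generalized almost contact structure on Wᵢ = Vᵢ × Vᵢ* for i = 1, 2. Define 𝒥 : W₁ × W₂ → W₁ × W₂ by 𝒥(w₁, w₂) = (Φ₁w₁ − 2⟨E₊,₂, w₂⟩E₊,₁ − 2⟨E₋,₂, w₂⟩E₋,₁, Φ₂w₂ + 2⟨E₊,₁, w₁⟩E₊,₂ + 2⟨E₋,₁, w₁⟩E₋,₂). Then 𝒥∘𝒥 = −Id and 𝒥 is skew-adjoint for the product pairing ⟨(w₁,w₂),(u₁,u₂)⟩ = ⟨w₁,u₁⟩ + ⟨w₂,u₂⟩; that is, 𝒥 is a generalized almost complex structure on W₁ × W₂. -/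

import Mathlib

open Module

noncomputable section

/-- The generalized tangent space `W = V × V*`. -/
abbrev GT (V : Type*) [AddCommGroup V] [Module ℝ V] := V × (V →ₗ[ℝ] ℝ)

/-- The canonical symmetric pairing `⟨(X,α),(Y,β)⟩ = (β X + α Y)/2` on `W = V × V*`. -/
def gpair {V : Type*} [AddCommGroup V] [Module ℝ V] (u v : GT V) : ℝ :=
  (v.2 u.1 + u.2 v.1) / 2

/-- The sum pairing on the product `W₁ × W₂`. -/
def gpairProd {V₁ V₂ : Type*} [AddCommGroup V₁] [Module ℝ V₁] [AddCommGroup V₂]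
    [Module ℝ V₂] (p q : GT V₁ × GT V₂) : ℝ :=
  gpair p.1 q.1 + gpair p.2 q.2

section GeneralizedPairing

variable {V : Type*} [AddCommGroup V] [Module ℝ V]

theorem gpair_comm (u v : GT V) : gpair u v = gpair v u := by
  simp [gpair, add_comm]

theorem gpair_add_right (u v w : GT V) : gpair u (v + w) = gpair u v + gpair u w := by
  simp [gpair]; ring

theorem gpair_smul_right (c : ℝ) (u v : GT V) : gpair u (c • v) = c * gpair u v := by
  simp [gpair]; ring

theorem gpair_sub_right (u v w : GT V) : gpair u (v - w) = gpair u v - gpair u w := by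
  simp [gpair]; ring

theorem gpair_add_left (u v w : GT V) : gpair (u + v) w = gpair u w + gpair v w := by
  simp only [gpair_comm _ w, gpair_add_right]

theorem gpair_smul_left (c : ℝ) (u v : GT V) : gpair (c • u) v = c * gpair u v := by
  simp only [gpair_comm _ v, gpair_smul_right]

theorem gpair_sub_left (u v w : GT V) : gpair (u - v) w = gpair u w - gpair v w := by
  simp only [gpair_comm _ w, gpair_sub_right]

theorem gpair_zero_left (u : GT V) : gpair 0 u = 0 := by
  simp [gpair]

/-- The endomorphism of a generalized almost contact structure annihilates `E₊`
(and, by symmetry, `E₋`). -/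
theorem map_eq_zero_of_almost_contact {Φ : GT V →ₗ[ℝ] GT V} {E F : GT V}
    (hskew : ∀ u v : GT V, gpair (Φ u) v = - gpair u (Φ v))
    (hsq : ∀ w : GT V, Φ (Φ w) = -w + (2 * gpair F w) • E + (2 * gpair E w) • F)
    (hE : gpair E E = 0) (hEF : 2 * gpair E F = 1) : Φ E = 0 := by
  have hEE : gpair E (Φ E) = 0 := by
    have := hskew E E
    rw [gpair_comm] at this
    linarith
  have hsqE : Φ (Φ E) = 0 := by
    rw [hsq, gpair_comm F, hEF, hE]
    simp
  have hΦE : Φ E = (2 * gpair F (Φ E)) • E := by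
    have h := hsq (Φ E)
    rw [hsqE, map_zero, hEE, mul_zero, zero_smul, add_zero] at h
    exact (neg_add_eq_zero.mp h.symm)
  set a := 2 * gpair F (Φ E) with ha
  have h : a * (a * gpair E F) = 0 := by
    rw [← gpair_smul_left, ← gpair_smul_left, ← hΦE, ← map_smul, ← hΦE, hsqE,
      gpair_zero_left]
  have ha0 : a = 0 := by
    have : a * a = 0 := by linear_combination 2 * h - a * a * hEF
    exact mul_self_eq_zero.mp this
  rw [hΦE, ha0, zero_smul]

/-- If a skew-adjoint map annihilates `E`, its range is orthogonal to `E`. -/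
theorem gpair_map_eq_zero {Φ : GT V →ₗ[ℝ] GT V} {E : GT V}
    (hskew : ∀ u v : GT V, gpair (Φ u) v = - gpair u (Φ v)) (hE : Φ E = 0) (w : GT V) :
    gpair E (Φ w) = 0 := by
  have := hskew E w
  rw [hE, gpair_zero_left] at this
  linarith

end GeneralizedPairing

/-- Given generalized almost contact structures `(Φᵢ, E₊ᵢ, E₋ᵢ)` on
`Wᵢ = Vᵢ × Vᵢ*` (i = 1,2), the map
`𝒥(w₁,w₂) = (Φ₁w₁ − 2⟨E₊₂,w₂⟩E₊₁ − 2⟨E₋₂,w₂⟩E₋₁, Φ₂w₂ + 2⟨E₊₁,w₁⟩E₊₂ + 2⟨E₋₁,w₁⟩E₋₂)`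
is a generalized almost complex structure on `W₁ × W₂`: it is linear, `𝒥∘𝒥 = −Id`, and
it is skew-adjoint for the sum pairing. -/
theorem stmt13 {V₁ V₂ : Type*} [AddCommGroup V₁] [Module ℝ V₁] [FiniteDimensional ℝ V₁]
    [AddCommGroup V₂] [Module ℝ V₂] [FiniteDimensional ℝ V₂]
    (Φ₁ : GT V₁ →ₗ[ℝ] GT V₁) (Ep₁ Em₁ : GT V₁)
    (Φ₂ : GT V₂ →ₗ[ℝ] GT V₂) (Ep₂ Em₂ : GT V₂)
    (hskew₁ : ∀ u v : GT V₁, gpair (Φ₁ u) v = - gpair u (Φ₁ v))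
    (hsq₁ : ∀ w : GT V₁,
      Φ₁ (Φ₁ w) = -w + (2 * gpair Em₁ w) • Ep₁ + (2 * gpair Ep₁ w) • Em₁)
    (hpp₁ : gpair Ep₁ Ep₁ = 0) (hmm₁ : gpair Em₁ Em₁ = 0)
    (hpm₁ : 2 * gpair Ep₁ Em₁ = 1)
    (hskew₂ : ∀ u v : GT V₂, gpair (Φ₂ u) v = - gpair u (Φ₂ v))
    (hsq₂ : ∀ w : GT V₂,
      Φ₂ (Φ₂ w) = -w + (2 * gpair Em₂ w) • Ep₂ + (2 * gpair Ep₂ w) • Em₂)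
    (hpp₂ : gpair Ep₂ Ep₂ = 0) (hmm₂ : gpair Em₂ Em₂ = 0)
    (hpm₂ : 2 * gpair Ep₂ Em₂ = 1) :
    ∀ J : GT V₁ × GT V₂ → GT V₁ × GT V₂,
      (J = fun p =>
        (Φ₁ p.1 - (2 * gpair Ep₂ p.2) • Ep₁ - (2 * gpair Em₂ p.2) • Em₁,
         Φ₂ p.2 + (2 * gpair Ep₁ p.1) • Ep₂ + (2 * gpair Em₁ p.1) • Em₂)) →
      (∀ p q : GT V₁ × GT V₂, J (p + q) = J p + J q) ∧
      (∀ (c : ℝ) (p : GT V₁ × GT V₂), J (c • p) = c • J p) ∧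
      (∀ p : GT V₁ × GT V₂, J (J p) = -p) ∧
      (∀ p q : GT V₁ × GT V₂, gpairProd (J p) q = - gpairProd p (J q)) := by
  rintro J rfl
  have hmp₁ : 2 * gpair Em₁ Ep₁ = 1 := by rw [gpair_comm, hpm₁]
  have hmp₂ : 2 * gpair Em₂ Ep₂ = 1 := by rw [gpair_comm, hpm₂]
  have hp₁ := map_eq_zero_of_almost_contact hskew₁ hsq₁ hpp₁ hpm₁
  have hp₂ := map_eq_zero_of_almost_contact hskew₂ hsq₂ hpp₂ hpm₂
  have hm₁ := map_eq_zero_of_almost_contact hskew₁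
    (fun w => (hsq₁ w).trans (add_right_comm _ _ _)) hmm₁ hmp₁
  have hm₂ := map_eq_zero_of_almost_contact hskew₂
    (fun w => (hsq₂ w).trans (add_right_comm _ _ _)) hmm₂ hmp₂
  refine ⟨fun p q => ?_, fun c p => ?_, fun p => ?_, fun p q => ?_⟩
  · refine Prod.ext ?_ ?_ <;>
      simp only [Prod.fst_add, Prod.snd_add (M := GT V₁), map_add, gpair_add_right] <;> module
  · refine Prod.ext ?_ ?_ <;>
      simp only [Prod.smul_fst, Prod.smul_snd (α := GT V₁), map_smul, gpair_smul_right] <;> module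
  · have hpm₁' : gpair Ep₁ Em₁ = 1 / 2 := by linarith
    have hpm₂' : gpair Ep₂ Em₂ = 1 / 2 := by linarith
    have hmp₁' : gpair Em₁ Ep₁ = 1 / 2 := by linarith
    have hmp₂' : gpair Em₂ Ep₂ = 1 / 2 := by linarith
    refine Prod.ext ?_ ?_
    · simp only [map_sub, map_smul, hp₁, hm₁, hsq₁, gpair_add_right, gpair_smul_right,
        gpair_map_eq_zero hskew₂ hp₂, gpair_map_eq_zero hskew₂ hm₂, hpp₂, hmm₂, hpm₂', hmp₂',
        Prod.fst_neg]
      module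
    · simp only [map_add, map_smul, hp₂, hm₂, hsq₂, gpair_sub_right, gpair_smul_right,
        gpair_map_eq_zero hskew₁ hp₁, gpair_map_eq_zero hskew₁ hm₁, hpp₁, hmm₁, hpm₁', hmp₁',
        Prod.snd_neg]
      module
  · simp only [gpairProd, gpair_add_left, gpair_sub_left, gpair_smul_left, gpair_add_right,
      gpair_sub_right, gpair_smul_right, hskew₁, hskew₂, gpair_comm p.1 Ep₁,
      gpair_comm p.1 Em₁, gpair_comm p.2 Ep₂, gpair_comm p.2 Em₂]
    ring
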